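/- Let S² be the unit sphere in ℝ³ with canonical surface measure σ, and for x ∈ S² let P(x) = I₃ − xxᵀ. Let V ⊆ S² be a nonempty relatively open subset whose relative boundary ∂V in S² is a smooth embedded closed curve. Let q : ℝ³ → (0,∞) and p̄ : ℝ³ → (0,∞) be twice continuously differentiable on a neighborhood of the closure of V, and let g : ℝ³ → [0,∞) be continuously differentiable with g(x') = 0 for every x' ∈ ∂V. Assume all integrals below are finite. Then the weighted manifold score matching objective satisfies the exact identity: ∫_V q(x) g(x) ⟨P(x)(∇log q(x) − ∇log p̄(x)), P(x)(∇log q(x) − ∇log p̄(x))⟩ dσ(x) = ∫_V q(x) g(x) ⟨P(x)∇log p̄(x), P(x)∇log p̄(x)⟩ dσ(x) + 2∫_V q(x) g(x) Δ_M log p̄(x) dσ(x) + 2∫_V q(x) ⟨P(x)∇g(x), P(x)∇log p̄(x)⟩ dσ(x) + C_q, where C_q = ∫_V q(x) g(x) ⟨P(x)∇log q(x), P(x)∇log q(x)⟩ dσ(x) does not depend on p̄. -/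

import Mathlib

open MeasureTheory Real
open scoped RealInnerProductSpace

noncomputable section

/-- Euclidean 3-space. -/
abbrev E3 : Type := EuclideanSpace ℝ (Fin 3)

/-- The orthogonal projection matrix `P(x) = I₃ - x xᵀ` applied to a vector `v`. -/
def sphProj (x v : E3) : E3 := v - (⟪x, v⟫) • x

/-- `tr (P(x) ⬝ J(x))` where `J(x)` is the Jacobian matrix at `x` of `F : ℝ³ → ℝ³`
(using symmetry of `P(x)`: `tr (P J) = ∑ i ⟪P eᵢ, J eᵢ⟫`). -/
def trProjJac (F : E3 → E3) (x : E3) : ℝ :=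
  ∑ i : Fin 3, ⟪sphProj x (EuclideanSpace.single i 1), fderiv ℝ F x (EuclideanSpace.single i 1)⟫

/-- The Laplace–Beltrami operator on the unit sphere `S² ⊂ ℝ³`:
`Δ_M u (x) = tr (P(x) ⬝ J(x))` where `J(x)` is the Jacobian at `x` of `y ↦ P(y) ∇u(y)`. -/
def lapBel (u : E3 → ℝ) (x : E3) : ℝ :=
  trProjJac (fun y => sphProj y (gradient u y)) x

/-- The (Euclidean) score function `∇ log f`. -/
def gradLog (f : E3 → ℝ) (x : E3) : E3 := gradient (fun y => Real.log (f y)) x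

/-- `s` is a smooth embedded closed curve in `ℝ³`. -/
def IsSmoothEmbeddedClosedCurve (s : Set E3) : Prop :=
  ∃ γ : ℝ → E3, ContDiff ℝ (⊤ : ℕ∞) γ ∧ Function.Periodic γ (2 * π) ∧
    (∀ t, deriv γ t ≠ 0) ∧ Set.InjOn γ (Set.Ico 0 (2 * π)) ∧ Set.range γ = s


/-- Infinitesimal rotation about the `i`-th axis. -/
def Kf : Fin 3 → E3 → E3
  | 0, y => !₂[0, -y 2, y 1]
  | 1, y => !₂[y 2, 0, -y 0]
  | 2, y => !₂[-y 1, y 0, 0]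

def Kc (i : Fin 3) : E3 →L[ℝ] E3 := LinearMap.toContinuousLinearMap
  { toFun := Kf i
    map_add' := by
      intro x y
      fin_cases i <;> ext j <;> fin_cases j <;> simp [Kf] <;> ring
    map_smul' := by
      intro c y
      fin_cases i <;> ext j <;> fin_cases j <;> simp [Kf] }

lemma Kc_apply (i : Fin 3) (y : E3) : Kc i y = Kf i y := rfl

lemma Kc_cube (i : Fin 3) (y : E3) : Kc i (Kc i (Kc i y)) = - Kc i y := by
  simp only [Kc_apply]
  fin_cases i <;> ext j <;> fin_cases j <;> simp [Kf]

/-- Rotation (Rodrigues formula). -/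
def rot (i : Fin 3) (t : ℝ) (x : E3) : E3 :=
  x + Real.sin t • Kc i x + (1 - Real.cos t) • Kc i (Kc i x)

lemma rot_zero (i : Fin 3) (x : E3) : rot i 0 x = x := by simp [rot]

lemma rot_norm (i : Fin 3) (t : ℝ) (x : E3) : ‖rot i t x‖ = ‖x‖ := by
  have h := Real.sin_sq_add_cos_sq t
  rw [EuclideanSpace.norm_eq, EuclideanSpace.norm_eq]
  congr 1
  simp only [Fin.sum_univ_three, Real.norm_eq_abs, sq_abs, rot, Kc_apply]
  fin_cases i <;> simp [Kf]
  · linear_combination (x 1 ^ 2 + x 2 ^ 2) * h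
  · linear_combination (x 0 ^ 2 + x 2 ^ 2) * h
  · linear_combination (x 0 ^ 2 + x 1 ^ 2) * h

lemma rot_inv (i : Fin 3) (t : ℝ) (x : E3) : rot i t (rot i (-t) x) = x := by
  have h := Real.sin_sq_add_cos_sq t
  simp only [rot, Real.sin_neg, Real.cos_neg, map_add, map_smul, Kc_cube, map_neg]
  have : x + -sin t • (Kc i) x + (1 - cos t) • (Kc i) ((Kc i) x) +
        sin t • ((Kc i) x + -sin t • (Kc i) ((Kc i) x) + (1 - cos t) • -(Kc i) x) +
      (1 - cos t) • ((Kc i) ((Kc i) x) + -sin t • -(Kc i) x + (1 - cos t) • -(Kc i) ((Kc i) x)) = 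
      x + (1 - (sin t ^ 2 + cos t ^ 2)) • (Kc i) ((Kc i) x) := by module
  rw [this, h]; simp

lemma rot_isometry (i : Fin 3) (t : ℝ) : Isometry (rot i t) := by
  refine Isometry.of_dist_eq fun x y => ?_
  have : rot i t x - rot i t y = rot i t (x - y) := by
    simp only [rot, map_sub]; module
  rw [dist_eq_norm, this, rot_norm, dist_eq_norm]

def rotE (i : Fin 3) (t : ℝ) : E3 ≃ᵢ E3 :=
  IsometryEquiv.mk' (rot i t) (rot i (-t)) (rot_inv i t) (rot_isometry i t)

lemma rot_hasDerivAt (i : Fin 3) (t : ℝ) (x : E3) :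
    HasDerivAt (fun s => rot i s x) (Kc i (rot i t x)) t := by
  have h1 := ((Real.hasDerivAt_sin t).smul_const (Kc i x)).const_add x
  have h2 := (((Real.hasDerivAt_cos t).const_sub 1).smul_const (Kc i (Kc i x)))
  have h := h1.add h2
  refine h.congr_deriv ?_
  simp only [rot, map_add, map_smul, Kc_cube]
  module

lemma sphere_finite : μH[2] (Metric.sphere (0 : E3) 1) < ⊤ := by
  let f : (Fin 2 → ℝ) → E3 := fun v =>
    !₂[Real.sin (v 0) * Real.cos (v 1), Real.sin (v 0) * Real.sin (v 1), Real.cos (v 0)]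
  let s : Set (Fin 2 → ℝ) := Set.Icc (fun _ => -10) (fun _ => 10)
  have hf : ContDiff ℝ 1 f := by
    rw [contDiff_euclidean]
    intro i
    fin_cases i <;> simp [f] <;> fun_prop
  obtain ⟨K, hK⟩ := hf.contDiffOn.exists_lipschitzOnWith (s := s) (by simp) (convex_Icc _ _)
    isCompact_Icc
  have hsub : Metric.sphere (0 : E3) 1 ⊆ f '' s := by
    intro x hx
    have hn : x 0 ^ 2 + x 1 ^ 2 + x 2 ^ 2 = 1 := by
      have : ‖x‖ ^ 2 = 1 := by simp [mem_sphere_zero_iff_norm.1 hx]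
      rw [EuclideanSpace.norm_sq_eq] at this
      simpa [Fin.sum_univ_three] using this
    have hpi : Real.pi < 4 := Real.pi_lt_d2.trans (by norm_num)
    let z : ℂ := ⟨x 0, x 1⟩
    have hz : ‖z‖ = Real.sqrt (1 - x 2 ^ 2) := by
      rw [Complex.norm_def, Complex.normSq_apply]; congr 1; simp only [z]; linarith
    refine ⟨![Real.arccos (x 2), z.arg], ?_, ?_⟩
    · have a1 := Real.arccos_nonneg (x 2)
      have a2 := Real.arccos_le_pi (x 2)
      have a3 := Complex.neg_pi_lt_arg z
      have a4 := Complex.arg_le_pi z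
      refine ⟨fun i => ?_, fun i => ?_⟩ <;> fin_cases i <;> simp <;> linarith
    · have b1 : -1 ≤ x 2 := by nlinarith [sq_nonneg (x 0), sq_nonneg (x 1)]
      have b2 : x 2 ≤ 1 := by nlinarith [sq_nonneg (x 0), sq_nonneg (x 1)]
      ext j
      fin_cases j
      · simp [f, Real.sin_arccos, ← hz, Complex.norm_mul_cos_arg]; rfl
      · simp [f, Real.sin_arccos, ← hz, Complex.norm_mul_sin_arg]; rfl
      · simp [f, Real.cos_arccos b1 b2]
  have h1 := hK.hausdorffMeasure_image_le (d := 2) (by norm_num)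
  have h2 : (μH[2] : Measure (Fin 2 → ℝ)) = volume := by
    have := hausdorffMeasure_pi_real (ι := Fin 2)
    simpa using this
  refine lt_of_le_of_lt (measure_mono hsub) (lt_of_le_of_lt h1 ?_)
  rw [h2]
  exact ENNReal.mul_lt_top (ENNReal.rpow_lt_top_of_nonneg (by norm_num) (by simp))
    (isCompact_Icc.measure_lt_top)

lemma curve_deriv (i : Fin 3)
    (V : Set E3) (hVsub : V ⊆ Metric.sphere (0 : E3) 1)
    (hVopen : ∃ W : Set E3, IsOpen W ∧ V = W ∩ Metric.sphere (0 : E3) 1)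
    (h : E3 → ℝ) (hd : ∀ x ∈ closure V, DifferentiableAt ℝ h x)
    (h0 : ∀ x ∈ closure V \ V, h x = 0 ∧ fderiv ℝ h x = 0)
    (x : E3) (hx : x ∈ Metric.sphere (0 : E3) 1) (t : ℝ) :
    HasDerivAt (fun s => V.indicator h (rot i s x))
      (V.indicator (fun y => fderiv ℝ h y (Kc i y)) (rot i t x)) t := by
  have hc := rot_hasDerivAt i t x
  have hcc : ContinuousAt (fun s => rot i s x) t := hc.continuousAt
  have hS : ∀ s, rot i s x ∈ Metric.sphere (0 : E3) 1 := fun s => by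
    rw [mem_sphere_zero_iff_norm] at *; rw [rot_norm, hx]
  by_cases hcl : rot i t x ∈ closure V
  · have hh : HasDerivAt (fun s => h (rot i s x)) (fderiv ℝ h (rot i t x) (Kc i (rot i t x))) t :=
      (hd _ hcl).hasFDerivAt.comp_hasDerivAt t hc
    by_cases hV : rot i t x ∈ V
    · obtain ⟨W, hW, rfl⟩ := hVopen
      rw [Set.indicator_of_mem hV]
      refine hh.congr_of_eventuallyEq ?_
      filter_upwards [hcc.preimage_mem_nhds (hW.mem_nhds hV.1)] with s hs
      exact Set.indicator_of_mem (show rot i s x ∈ W ∩ Metric.sphere (0 : E3) 1 from ⟨hs, hS s⟩) _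
    · obtain ⟨e1, e2⟩ := h0 _ ⟨hcl, hV⟩
      rw [Set.indicator_of_notMem hV]
      rw [e2] at hh
      rw [hasDerivAt_iff_isLittleO] at hh ⊢
      refine Asymptotics.IsBigO.trans_isLittleO ?_ hh
      refine Asymptotics.IsBigO.of_bound 1 (Filter.Eventually.of_forall fun s => ?_)
      rw [Set.indicator_of_notMem hV, e1]
      simp only [sub_zero, smul_zero, one_mul, zero_apply]
      exact norm_indicator_le_norm_self _ _
  · rw [Set.indicator_of_notMem (fun hV => hcl (subset_closure hV))]
    refine (hasDerivAt_const t (0 : ℝ)).congr_of_eventuallyEq ?_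
    filter_upwards [hcc.preimage_mem_nhds (isClosed_closure.isOpen_compl.mem_nhds hcl)] with s hs
    exact Set.indicator_of_notMem (fun hV => hs (subset_closure hV)) _

lemma int_rot (i : Fin 3)
    (V : Set E3) (hVsub : V ⊆ Metric.sphere (0 : E3) 1)
    (hVopen : ∃ W : Set E3, IsOpen W ∧ V = W ∩ Metric.sphere (0 : E3) 1)
    (U : Set E3) (hUopen : IsOpen U) (hclVU : closure V ⊆ U)
    (h : E3 → ℝ) (hh : ContDiffOn ℝ 1 h U)
    (h0 : ∀ x ∈ closure V \ V, h x = 0 ∧ fderiv ℝ h x = 0) :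
    IntegrableOn (fun y => fderiv ℝ h y (Kc i y)) V μH[2] ∧
      ∫ y in V, fderiv ℝ h y (Kc i y) ∂μH[2] = 0 := by
  have hVm : MeasurableSet V := by
    obtain ⟨W, hW, rfl⟩ := hVopen
    exact hW.measurableSet.inter Metric.isClosed_sphere.measurableSet
  have hSm : MeasurableSet (Metric.sphere (0 : E3) 1) := Metric.isClosed_sphere.measurableSet
  have hcomp : IsCompact (closure V) :=
    (isCompact_sphere (0 : E3) 1).of_isClosed_subset isClosed_closure
      (closure_minimal hVsub Metric.isClosed_sphere)
  have hc1 : ContinuousOn h (closure V) := hh.continuousOn.mono hclVU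
  have hc2 : ContinuousOn (fun y => fderiv ℝ h y (Kc i y)) (closure V) :=
    ((hh.continuousOn_fderiv_of_isOpen hUopen le_rfl).mono hclVU).clm_apply
      (Kc i).continuous.continuousOn
  obtain ⟨C1, hC1⟩ := hcomp.exists_bound_of_continuousOn hc1
  obtain ⟨C2, hC2⟩ := hcomp.exists_bound_of_continuousOn hc2
  have bd : ∀ (f : E3 → ℝ) (C : ℝ), (∀ x ∈ closure V, ‖f x‖ ≤ C) →
      ∀ x, ‖V.indicator f x‖ ≤ |C| := by
    intro f C hC x
    by_cases hx : x ∈ V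
    · rw [Set.indicator_of_mem hx]; exact (hC x (subset_closure hx)).trans (le_abs_self _)
    · rw [Set.indicator_of_notMem hx]; simp
  have ms : ∀ f : E3 → ℝ, ContinuousOn f (closure V) → Measurable (V.indicator f) := by
    intro f hf
    classical
    have := (hf.mono subset_closure).measurable_piecewise (g := fun _ => (0 : ℝ))
      continuousOn_const hVm
    exact Set.piecewise_eq_indicator (s := V) (f := f) ▸ this
  let μ : Measure E3 := μH[2].restrict (Metric.sphere (0 : E3) 1)
  have : IsFiniteMeasure μ := ⟨by simpa [μ] using sphere_finite⟩
  have key := hasDerivAt_integral_of_dominated_loc_of_deriv_le (μ := μ) (x₀ := (0 : ℝ))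
    (s := Set.univ)
    (F := fun t x => V.indicator h (rot i t x))
    (F' := fun t x => V.indicator (fun y => fderiv ℝ h y (Kc i y)) (rot i t x))
    (bound := fun _ => |C2|) Filter.univ_mem
    (Filter.Eventually.of_forall fun t =>
      ((ms h hc1).comp (rot_isometry i t).continuous.measurable).aestronglyMeasurable)
    (Integrable.of_bound
      ((ms h hc1).comp (rot_isometry i 0).continuous.measurable).aestronglyMeasurable |C1|
      (Filter.Eventually.of_forall fun x => bd h C1 hC1 _))
    ((ms _ hc2).comp (rot_isometry i 0).continuous.measurable).aestronglyMeasurable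
    (Filter.Eventually.of_forall fun x t _ => bd _ C2 hC2 _)
    (integrable_const _)
    (by
      refine (ae_restrict_mem hSm).mono fun x hx t _ => ?_
      exact curve_deriv i V hVsub hVopen h
        (fun y hy => (hh.differentiableOn one_ne_zero).differentiableAt
          (hUopen.mem_nhds (hclVU hy))) h0 x hx t)
  have hinv : ∀ t, ∫ x, V.indicator h (rot i t x) ∂μ = ∫ x, V.indicator h x ∂μ := by
    intro t
    have hp := ((rotE i t).measurePreserving_hausdorffMeasure 2).restrict_preimage hSm
    have hpre : (rotE i t) ⁻¹' (Metric.sphere (0 : E3) 1) = Metric.sphere (0 : E3) 1 := by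
      ext x
      change rot i t x ∈ Metric.sphere (0 : E3) 1 ↔ x ∈ Metric.sphere (0 : E3) 1
      rw [mem_sphere_zero_iff_norm, mem_sphere_zero_iff_norm, rot_norm]
    rw [hpre] at hp
    exact hp.integral_comp (rotE i t).toHomeomorph.measurableEmbedding (V.indicator h)
  obtain ⟨k1, k2⟩ := key
  simp only [hinv] at k2
  have k3 := k2.unique (hasDerivAt_const (0 : ℝ) _)
  simp only [rot_zero] at k1 k3
  have hr : μ.restrict V = μH[2].restrict V := by
    rw [Measure.restrict_restrict hVm, Set.inter_eq_left.2 hVsub]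
  rw [integral_indicator hVm, hr] at k3
  rw [integrable_indicator_iff hVm, IntegrableOn, hr] at k1
  exact ⟨k1, k3⟩

lemma trace_identity (y a b c : E3) (H : E3 →L[ℝ] E3) (hy : ‖y‖ = 1) :
    (∑ i : Fin 3, (⟪c, Kc i (Kc i y)⟫ + ⟪H (Kc i y), Kc i y⟫)
      = ∑ i : Fin 3, ⟪sphProj y (EuclideanSpace.single i 1),
        H (EuclideanSpace.single i 1)
          - (⟪y, c⟫ • EuclideanSpace.single i 1
            + (⟪y, H (EuclideanSpace.single i 1)⟫ + ⟪EuclideanSpace.single i 1, c⟫) • y)⟫)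
    ∧ ∑ i : Fin 3, ⟪a, Kc i y⟫ * ⟪c, Kc i y⟫ = ⟪sphProj y a, sphProj y c⟫ := by
  have hn : y 0 ^ 2 + y 1 ^ 2 + y 2 ^ 2 = 1 := by
    have : ‖y‖ ^ 2 = 1 := by simp [hy]
    rw [EuclideanSpace.norm_sq_eq] at this
    simpa [Fin.sum_univ_three] using this
  have hv : ∀ v : E3, v = v 0 • EuclideanSpace.single 0 1 + v 1 • EuclideanSpace.single 1 1
      + v 2 • EuclideanSpace.single 2 1 := by
    intro v; ext j; fin_cases j <;> simp
  have hH : ∀ v : E3, H v = v 0 • H (EuclideanSpace.single 0 1)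
      + v 1 • H (EuclideanSpace.single 1 1) + v 2 • H (EuclideanSpace.single 2 1) := by
    intro v; conv_lhs => rw [hv v]
    simp
  constructor
  · rw [Fin.sum_univ_three, Fin.sum_univ_three, hH (Kc 0 y), hH (Kc 1 y), hH (Kc 2 y)]
    generalize H (EuclideanSpace.single 0 1) = h0
    generalize H (EuclideanSpace.single 1 1) = h1
    generalize H (EuclideanSpace.single 2 1) = h2
    simp [Kc_apply, Kf, sphProj, PiLp.inner_apply, Fin.sum_univ_three]
    linear_combination (h0 0 + h1 1 + h2 2 - 2 * (y 0 * c 0 + y 1 * c 1 + y 2 * c 2)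
      - y 0 * (h0 0 * y 0 + h0 1 * y 1 + h0 2 * y 2)
      - y 1 * (h1 0 * y 0 + h1 1 * y 1 + h1 2 * y 2)
      - y 2 * (h2 0 * y 0 + h2 1 * y 1 + h2 2 * y 2)) * hn
  · simp [Kc_apply, Kf, sphProj, PiLp.inner_apply, Fin.sum_univ_three]
    linear_combination (a 0 * c 0 + a 1 * c 1 + a 2 * c 2
      - (a 0 * y 0 + a 1 * y 1 + a 2 * y 2) * (c 0 * y 0 + c 1 * y 1 + c 2 * y 2)) * hn

lemma pointwise_identity (U : Set E3) (hUopen : IsOpen U) (q g u : E3 → ℝ) (y : E3)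
    (hyU : y ∈ U) (hy : ‖y‖ = 1) (hqpos : ∀ x, 0 < q x)
    (hq : DifferentiableAt ℝ q y) (hg : DifferentiableAt ℝ g y)
    (hu : DifferentiableAt ℝ (gradient u) y) :
    ∑ i : Fin 3, fderiv ℝ (fun z => g z * (q z * ⟪gradient u z, Kc i z⟫)) y (Kc i y)
      = q y * g y * lapBel u y + q y * ⟪sphProj y (gradient g y), sphProj y (gradient u y)⟫
        + q y * g y * ⟪sphProj y (gradLog q y), sphProj y (gradient u y)⟫ := by
  have hlog : ∀ v, ⟪gradLog q y, v⟫ = (q y)⁻¹ * fderiv ℝ q y v := by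
    intro v
    rw [gradLog, inner_gradient_left, fderiv.log hq (hqpos y).ne']
    simp
  have hD : ∀ i, fderiv ℝ (fun z => g z * (q z * ⟪gradient u z, Kc i z⟫)) y (Kc i y)
      = q y * g y * (⟪gradient u y, Kc i (Kc i y)⟫ + ⟪fderiv ℝ (gradient u) y (Kc i y), Kc i y⟫)
        + q y * (⟪gradient g y, Kc i y⟫ * ⟪gradient u y, Kc i y⟫)
        + q y * g y * (⟪gradLog q y, Kc i y⟫ * ⟪gradient u y, Kc i y⟫) := by
    intro i
    have h1 := hg.hasFDerivAt.mul (hq.hasFDerivAt.mul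
      (hu.hasFDerivAt.inner ℝ (Kc i).hasFDerivAt))
    have h2 : HasFDerivAt (fun z => g z * (q z * ⟪gradient u z, Kc i z⟫)) _ y := h1
    rw [h2.fderiv, hlog, inner_gradient_left (f := g)]
    have := (hqpos y).ne'
    simp [fderivInnerCLM_apply]
    field_simp
    ring
  have hJ : ∀ v, fderiv ℝ (fun z => sphProj z (gradient u z)) y v
      = fderiv ℝ (gradient u) y v - (⟪y, gradient u y⟫ • v
            + (⟪y, fderiv ℝ (gradient u) y v⟫ + ⟪v, gradient u y⟫) • y) := by
    intro v
    have h1 := hu.hasFDerivAt.sub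
      (((hasFDerivAt_id (𝕜 := ℝ) y).inner ℝ hu.hasFDerivAt).smul (hasFDerivAt_id (𝕜 := ℝ) y))
    have h2 : HasFDerivAt (fun z => sphProj z (gradient u z)) _ y := h1
    rw [h2.fderiv]
    simp [fderivInnerCLM_apply]
  simp only [hD, Finset.sum_add_distrib, ← Finset.mul_sum]
  rw [(trace_identity y (gradient g y) 0 (gradient u y) 0 hy).2,
    (trace_identity y (gradLog q y) 0 (gradient u y) 0 hy).2]
  have := (trace_identity y 0 0 (gradient u y) (fderiv ℝ (gradient u) y) hy).1
  rw [Finset.sum_add_distrib] at this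
  rw [this]
  simp only [lapBel, trProjJac, hJ]

/-- **Truncated manifold score matching identity (Theorem 2 on `S²`).** -/
theorem truncated_manifold_score_matching_identity
    (V : Set E3) (hVsub : V ⊆ Metric.sphere (0 : E3) 1) (hVne : V.Nonempty)
    (hVopen : ∃ W : Set E3, IsOpen W ∧ V = W ∩ Metric.sphere (0 : E3) 1)
    (hcurve : IsSmoothEmbeddedClosedCurve (closure V \ V))
    (q pbar : E3 → ℝ) (hqpos : ∀ x, 0 < q x) (hppos : ∀ x, 0 < pbar x)
    (U : Set E3) (hUopen : IsOpen U) (hclVU : closure V ⊆ U)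
    (hqC : ContDiffOn ℝ 2 q U) (hpC : ContDiffOn ℝ 2 pbar U)
    (g : E3 → ℝ) (hgnn : ∀ x, 0 ≤ g x) (hgC : ContDiff ℝ 1 g)
    (hgbd : ∀ x ∈ closure V \ V, g x = 0)
    (h1 : IntegrableOn (fun x => q x * g x *
        ⟪sphProj x (gradLog q x - gradLog pbar x),
          sphProj x (gradLog q x - gradLog pbar x)⟫) V μH[2])
    (h2 : IntegrableOn (fun x => q x * g x *
        ⟪sphProj x (gradLog pbar x), sphProj x (gradLog pbar x)⟫) V μH[2])
    (h3 : IntegrableOn (fun x => q x * g x *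
        lapBel (fun y => Real.log (pbar y)) x) V μH[2])
    (h4 : IntegrableOn (fun x => q x *
        ⟪sphProj x (gradient g x), sphProj x (gradLog pbar x)⟫) V μH[2])
    (h5 : IntegrableOn (fun x => q x * g x *
        ⟪sphProj x (gradLog q x), sphProj x (gradLog q x)⟫) V μH[2]) :
    ∫ x in V, q x * g x *
        ⟪sphProj x (gradLog q x - gradLog pbar x),
          sphProj x (gradLog q x - gradLog pbar x)⟫ ∂μH[2]
      = (∫ x in V, q x * g x *
            ⟪sphProj x (gradLog pbar x), sphProj x (gradLog pbar x)⟫ ∂μH[2])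
        + 2 * (∫ x in V, q x * g x * lapBel (fun y => Real.log (pbar y)) x ∂μH[2])
        + 2 * (∫ x in V, q x *
            ⟪sphProj x (gradient g x), sphProj x (gradLog pbar x)⟫ ∂μH[2])
        + ∫ x in V, q x * g x *
            ⟪sphProj x (gradLog q x), sphProj x (gradLog q x)⟫ ∂μH[2] := by
  have hVm : MeasurableSet V := by
    obtain ⟨W, hW, rfl⟩ := hVopen
    exact hW.measurableSet.inter Metric.isClosed_sphere.measurableSet
  let u : E3 → ℝ := fun y => Real.log (pbar y)
  have huC : ContDiffOn ℝ 2 u U := hpC.log fun x _ => (hppos x).ne'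
  have hGC : ContDiffOn ℝ 1 (gradient u) U :=
    (InnerProductSpace.toDual ℝ E3).symm.contDiff.comp_contDiffOn
      (huC.fderiv_of_isOpen hUopen (by norm_num))
  have hqC1 : ContDiffOn ℝ 1 q U := hqC.of_le (by norm_num)
  have hwC : ∀ i, ContDiffOn ℝ 1 (fun z => q z * ⟪gradient u z, Kc i z⟫) U := fun i =>
    hqC1.mul (hGC.inner ℝ (Kc i).contDiff.contDiffOn)
  have hhC : ∀ i, ContDiffOn ℝ 1 (fun z => g z * (q z * ⟪gradient u z, Kc i z⟫)) U := fun i =>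
    hgC.contDiffOn.mul (hwC i)
  have hda : ∀ {F : Type} [NormedAddCommGroup F] [NormedSpace ℝ F] {f : E3 → F},
      ContDiffOn ℝ 1 f U → ∀ x ∈ closure V, DifferentiableAt ℝ f x := fun hf x hx =>
    (hf.differentiableOn one_ne_zero).differentiableAt (hUopen.mem_nhds (hclVU hx))
  have hgd : Differentiable ℝ g := hgC.differentiable one_ne_zero
  have h0 : ∀ i, ∀ x ∈ closure V \ V, g x * (q x * ⟪gradient u x, Kc i x⟫) = 0 ∧
      fderiv ℝ (fun z => g z * (q z * ⟪gradient u z, Kc i z⟫)) x = 0 := by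
    intro i x hx
    have g0 := hgbd x hx
    refine ⟨by rw [g0, zero_mul], ?_⟩
    have hmin : IsLocalMin g x := Filter.Eventually.of_forall fun z => by rw [g0]; exact hgnn z
    have hm : HasFDerivAt (fun z => g z * (q z * ⟪gradient u z, Kc i z⟫)) _ x :=
      (hgd x).hasFDerivAt.mul (hda (hwC i) x hx.1).hasFDerivAt
    rw [hm.fderiv, g0, hmin.fderiv_eq_zero, zero_smul, smul_zero, add_zero]
  have hI := fun i => int_rot i V hVsub hVopen U hUopen hclVU _ (hhC i) (h0 i)
  have hsum : ∫ x in V, (q x * g x * lapBel u x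
      + q x * ⟪sphProj x (gradient g x), sphProj x (gradLog pbar x)⟫
      + q x * g x * ⟪sphProj x (gradLog q x), sphProj x (gradLog pbar x)⟫) ∂μH[2] = 0 := by
    have e := integral_finsetSum (μ := μH[2].restrict V) Finset.univ
      (fun (i : Fin 3) _ => (hI i).1)
    simp only [(hI _).2, Finset.sum_const_zero] at e
    rw [← e]
    refine setIntegral_congr_fun hVm fun x hx => ?_
    exact (pointwise_identity U hUopen q g u x (hclVU (subset_closure hx))
      (mem_sphere_zero_iff_norm.1 (hVsub hx)) hqpos (hda hqC1 x (subset_closure hx)) (hgd x)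
      (hda hGC x (subset_closure hx))).symm
  have hexp : ∀ x, q x * g x * ⟪sphProj x (gradLog q x - gradLog pbar x),
          sphProj x (gradLog q x - gradLog pbar x)⟫
      = q x * g x * ⟪sphProj x (gradLog pbar x), sphProj x (gradLog pbar x)⟫
        + q x * g x * ⟪sphProj x (gradLog q x), sphProj x (gradLog q x)⟫
        - 2 * (q x * g x * ⟪sphProj x (gradLog q x), sphProj x (gradLog pbar x)⟫) := by
    intro x
    have : sphProj x (gradLog q x - gradLog pbar x)
        = sphProj x (gradLog q x) - sphProj x (gradLog pbar x) := by
      simp only [sphProj, inner_sub_right]; module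
    rw [this, inner_sub_left, inner_sub_right, inner_sub_right,
      real_inner_comm (sphProj x (gradLog q x)) (sphProj x (gradLog pbar x))]
    ring
  have h6 : IntegrableOn (fun x => q x * g x *
      ⟪sphProj x (gradLog q x), sphProj x (gradLog pbar x)⟫) V μH[2] := by
    have := ((h2.add h5).sub h1).const_mul (1 / 2)
    refine this.congr (Filter.Eventually.of_forall fun x => ?_)
    simp only [Pi.add_apply, Pi.sub_apply, hexp]
    ring
  have h34 : IntegrableOn (fun x => q x * g x * lapBel u x
      + q x * ⟪sphProj x (gradient g x), sphProj x (gradLog pbar x)⟫) V μH[2] := h3.add h4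
  have h25 : IntegrableOn (fun x => q x * g x *
        ⟪sphProj x (gradLog pbar x), sphProj x (gradLog pbar x)⟫
        + q x * g x * ⟪sphProj x (gradLog q x), sphProj x (gradLog q x)⟫) V μH[2] := h2.add h5
  rw [integral_add h34 h6, integral_add h3 h4] at hsum
  simp only [hexp]
  rw [integral_sub h25 (h6.const_mul 2), integral_add h2 h5, integral_const_mul]
  linear_combination (-2) * hsum
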